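/- Let Ω ⊆ ℍ be a symmetric slice domain and let f₁, …, fₙ : Ω → ℍ (n ≥ 1) be slice regular functions with no common zeros, i.e. for every q ∈ Ω there exists ℓ with f_ℓ(q) ≠ 0. Then there exist slice regular functions h₁, …, hₙ : Ω → ℍ such that for every q ∈ Ω one has Σ_{ℓ=1}^{n} T_ℓ(q) = 1, where T_ℓ(q) = f_ℓ(q) · h_ℓ(f_ℓ(q)⁻¹ q f_ℓ(q)) if f_ℓ(q) ≠ 0 and T_ℓ(q) = 0 if f_ℓ(q) = 0. (T_ℓ is the pointwise value of the regular product f_ℓ * h_ℓ; note that when f_ℓ(q) ≠ 0 the point f_ℓ(q)⁻¹ q f_ℓ(q) lies on the same sphere x + y𝕊 as q, hence in Ω.) -/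

import Mathlib

noncomputable section

/-- The 2-sphere of quaternionic imaginary units. -/
def QSphere : Set (Quaternion ℝ) := {q | q ^ 2 = -1}

/-- The complex plane `L_I = ℝ + ℝI` through an imaginary unit `I`. -/
def sliceL (I : Quaternion ℝ) : Set (Quaternion ℝ) :=
  {q | ∃ x y : ℝ, q = (x : Quaternion ℝ) + (y : Quaternion ℝ) * I}

/-- The planar parametrization of the restriction of `f` to the slice `L_I`. -/
def sliceMap (f : Quaternion ℝ → Quaternion ℝ) (I : Quaternion ℝ) : ℝ × ℝ → Quaternion ℝ :=
  fun p => f ((p.1 : Quaternion ℝ) + (p.2 : Quaternion ℝ) * I)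

/-- `f` is holomorphic (has continuous partial derivatives and satisfies
`(∂/∂x + I ∂/∂y) f = 0`) at the points of `U` lying in the slice `L_I`. -/
def HoloSlice (f : Quaternion ℝ → Quaternion ℝ) (I : Quaternion ℝ)
    (U : Set (Quaternion ℝ)) : Prop :=
  ∀ x y : ℝ, (x : Quaternion ℝ) + (y : Quaternion ℝ) * I ∈ U →
    ContDiffAt ℝ 1 (sliceMap f I) (x, y) ∧
    fderiv ℝ (sliceMap f I) (x, y) (1, 0) + I * fderiv ℝ (sliceMap f I) (x, y) (0, 1) = 0

/-- `f` is slice regular on `Ω`. -/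
def SliceRegularOn (f : Quaternion ℝ → Quaternion ℝ) (Ω : Set (Quaternion ℝ)) : Prop :=
  ∀ I ∈ QSphere, HoloSlice f I Ω

/-- `Ω` is a symmetric slice domain. -/
def IsSymmSliceDomain (Ω : Set (Quaternion ℝ)) : Prop :=
  IsOpen Ω ∧ IsConnected Ω ∧ (∃ x : ℝ, (x : Quaternion ℝ) ∈ Ω) ∧
  (∀ I ∈ QSphere, IsConnected (Ω ∩ sliceL I)) ∧
  (∀ x y : ℝ, ∀ I ∈ QSphere, (x : Quaternion ℝ) + (y : Quaternion ℝ) * I ∈ Ω →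
    ∀ J ∈ QSphere, (x : Quaternion ℝ) + (y : Quaternion ℝ) * J ∈ Ω)

open Classical in
/-- The pointwise value of the regular product `f * h`:
`(f*h)(q) = f(q) · h(f(q)⁻¹ q f(q))` if `f(q) ≠ 0`, and `0` if `f(q) = 0`. -/
def starMulVal (f h : Quaternion ℝ → Quaternion ℝ) (q : Quaternion ℝ) : Quaternion ℝ :=
  if f q = 0 then 0 else f q * h ((f q)⁻¹ * q * f q)

section

open Filter Topology

/-- Local analytic functions that agree with one function on punctured neighbourhoods glue along
the diagonal. -/
theorem diagonal_eventuallyEq_of_punctured {D : Set ℂ} (hD : IsOpen D) {F : ℂ → ℂ}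
    {φ : ℂ → ℂ → ℂ} (hφ : ∀ c ∈ D, AnalyticAt ℂ (φ c) c)
    (hF : ∀ c ∈ D, ∀ᶠ z in 𝓝[≠] c, F z = φ c z) {c : ℂ} (hc : c ∈ D) :
    (fun z => φ z z) =ᶠ[𝓝 c] φ c := by
  have h1 : ∀ᶠ z in 𝓝[≠] c, ∀ᶠ w in 𝓝 z, F w = φ c w :=
    eventually_nhdsNE_eventually_nhds_iff.2 (hF c hc)
  have h2 : ∀ᶠ z in 𝓝 c, AnalyticAt ℂ (φ c) z := (hφ c hc).eventually_analyticAt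
  have h3 : ∀ᶠ z in 𝓝 c, z ∈ D := hD.mem_nhds hc
  rw [eventually_nhdsWithin_iff] at h1
  filter_upwards [h1, h2, h3] with z hz1 hz2 hz3
  by_cases hzc : z = c
  · rw [hzc]
  · have h4 : φ z =ᶠ[𝓝[≠] z] φ c := by
      filter_upwards [hF z hz3, (hz1 hzc).filter_mono nhdsWithin_le_nhds] with w hw1 hw2
      rw [← hw1, hw2]
    have h5 := (ContinuousAt.eventuallyEq_nhds_iff_eventuallyEq_nhdsNE
      (hφ z hz3).continuousAt hz2.continuousAt).1 h4
    exact h5.eq_of_nhds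

/-- The standard exhaustion of a planar open set by compact sets. -/
def planarExhaustion (D : Set ℂ) (n : ℕ) : Set ℂ :=
  {z | ‖z‖ + 1 ≤ n ∧ ∀ b ∉ D, 1 ≤ n * ‖z - b‖}

theorem planarExhaustion_subset (D : Set ℂ) (n : ℕ) : planarExhaustion D n ⊆ D := by
  intro z hz
  by_contra h
  have := hz.2 z h
  simp at this
  linarith

theorem planarExhaustion_zero (D : Set ℂ) : planarExhaustion D 0 = ∅ := by
  ext z
  simp only [planarExhaustion, Set.mem_ofPred_eq, Set.mem_empty_iff_false, iff_false, not_and]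
  intro h
  have := norm_nonneg z
  push_cast at h
  linarith

theorem planarExhaustion_mono (D : Set ℂ) : Monotone (planarExhaustion D) := by
  intro m n hmn z hz
  have h : (m : ℝ) ≤ n := by exact_mod_cast hmn
  exact ⟨hz.1.trans h, fun b hb => (hz.2 b hb).trans (by gcongr)⟩

theorem isCompact_planarExhaustion (D : Set ℂ) (n : ℕ) : IsCompact (planarExhaustion D n) := by
  apply Metric.isCompact_of_isClosed_isBounded
  · have : planarExhaustion D n = {z | ‖z‖ + 1 ≤ n} ∩ ⋂ b ∈ Dᶜ, {z | 1 ≤ n * ‖z - b‖} := by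
      ext z
      simp [planarExhaustion]
    rw [this]
    refine (isClosed_le (by fun_prop) (by fun_prop)).inter ?_
    exact isClosed_biInter fun b _ => isClosed_le (by fun_prop) (by fun_prop)
  · refine (Metric.isBounded_closedBall (x := (0 : ℂ)) (r := n)).subset fun z hz => ?_
    rw [mem_closedBall_zero_iff]
    linarith [hz.1]

theorem exists_planarExhaustion_mem_nhds {D : Set ℂ} (hD : IsOpen D) {c : ℂ} (hc : c ∈ D) :
    ∃ n, planarExhaustion D n ∈ 𝓝 c := by
  obtain ⟨r, hr, hball⟩ := Metric.isOpen_iff.1 hD c hc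
  obtain ⟨n, hn⟩ := exists_nat_ge (max (2 / r) (‖c‖ + r + 1))
  have hn1 : 2 / r ≤ n := (le_max_left _ _).trans hn
  have hn2 : ‖c‖ + r + 1 ≤ n := (le_max_right _ _).trans hn
  refine ⟨n, mem_of_superset (Metric.ball_mem_nhds c (half_pos hr)) fun z hz => ⟨?_, ?_⟩⟩
  · rw [mem_ball_iff_norm] at hz
    have : ‖z‖ ≤ ‖c‖ + ‖z - c‖ := by
      simpa using norm_add_le c (z - c)
    linarith
  · intro b hb
    rw [mem_ball_iff_norm] at hz
    have hbr : r ≤ ‖b - c‖ := by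
      by_contra h
      exact hb (hball (mem_ball_iff_norm.2 (not_le.1 h)))
    have h1 : ‖b - c‖ ≤ ‖z - b‖ + ‖z - c‖ := by
      have := norm_sub_le (z - c) (z - b)
      simp only [sub_sub_sub_cancel_left] at this
      linarith
    have h2 : r / 2 ≤ ‖z - b‖ := by linarith
    calc (1 : ℝ) = 2 / r * (r / 2) := by field_simp
      _ ≤ n * ‖z - b‖ := by gcongr

/-- The exhausting sets are holomorphically convex. -/
theorem exists_peak_of_notMem_planarExhaustion {D : Set ℂ} {a : ℂ} {n : ℕ}
    (ha : a ∉ planarExhaustion D n) :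
    ∃ w : ℂ → ℂ, DifferentiableOn ℂ w D ∧ (a ∈ D → w a = 1) ∧
      ∃ ρ : ℝ, 0 ≤ ρ ∧ ρ < 1 ∧ ∀ z ∈ planarExhaustion D n, ‖w z‖ ≤ ρ := by
  rcases Nat.eq_zero_or_pos n with rfl | hn
  · exact ⟨fun _ => 1, by fun_prop, fun _ => rfl, 0, le_rfl, one_pos, by
      simp [planarExhaustion_zero]⟩
  have hn' : (1 : ℝ) ≤ n := by exact_mod_cast hn
  simp only [planarExhaustion, Set.mem_ofPred_eq, not_and_or, not_le, not_forall] at ha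
  rcases ha with ha | ⟨b, hb, hab⟩
  · have hapos : 0 < ‖a‖ := by linarith
    have ha0 : a ≠ 0 := norm_pos_iff.1 hapos
    refine ⟨fun z => z / a, by fun_prop, fun _ => div_self ha0, (n - 1) / ‖a‖,
      div_nonneg (by linarith) hapos.le, (div_lt_one hapos).2 (by linarith), fun z hz => ?_⟩
    rw [norm_div]
    gcongr
    linarith [hz.1]
  · refine ⟨fun z => (a - b) / (z - b), ?_, ?_, n * ‖a - b‖, by positivity, hab, fun z hz => ?_⟩
    · intro z hz
      have : z - b ≠ 0 := sub_ne_zero.2 fun h => hb (h ▸ hz)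
      fun_prop (disch := assumption)
    · intro haD
      exact div_self (sub_ne_zero.2 fun h => hb (h ▸ haD))
    · have h1 := hz.2 b hb
      have h2 : 0 < ‖z - b‖ := by
        by_contra h
        have : ‖z - b‖ = 0 := le_antisymm (not_lt.1 h) (norm_nonneg _)
        rw [this] at h1
        linarith
      rw [norm_div, div_le_iff₀ h2]
      nlinarith [norm_nonneg (a - b)]

/-- A pole outside an exhausting set can be multiplied by a function that agrees with `1` to high
order at the pole and makes the product small on the exhausting set. -/
theorem exists_damping_factor {D : Set ℂ} (hD : IsOpen D) {a : ℂ} (haD : a ∈ D) {n : ℕ}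
    (ha : a ∉ planarExhaustion D n) {P : ℂ → ℂ} (hP : ContinuousOn P (planarExhaustion D n))
    (m : ℕ) {ε : ℝ} (hε : 0 < ε) :
    ∃ e q : ℂ → ℂ, DifferentiableOn ℂ e D ∧ DifferentiableOn ℂ q D ∧
      (∀ z, e z = 1 + (z - a) ^ m * q z) ∧
      ∀ z ∈ planarExhaustion D n, ‖P z * e z‖ ≤ ε := by
  obtain ⟨w, hw, hwa, ρ, hρ0, hρ1, hρ⟩ := exists_peak_of_notMem_planarExhaustion ha
  obtain ⟨C, hC⟩ := (isCompact_planarExhaustion D n).exists_bound_of_continuousOn hP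
  have hC' : ∀ z ∈ planarExhaustion D n, ‖P z‖ ≤ |C| + 1 := fun z hz =>
    (hC z hz).trans ((le_abs_self C).trans (by linarith))
  have hCpos : 0 < |C| + 1 := by positivity
  have hcont : ContinuousAt (fun x : ℂ => 1 - (1 - x) ^ m) 0 := by fun_prop
  obtain ⟨δ, hδ, hδ'⟩ := Metric.continuousAt_iff.1 hcont (ε / (|C| + 1)) (by positivity)
  obtain ⟨N, hN⟩ := exists_pow_lt_of_lt_one hδ hρ1
  have hwN : DifferentiableOn ℂ (fun z => w z ^ N) D := hw.pow N
  have hs : DifferentiableOn ℂ (dslope (fun z => w z ^ N) a) D :=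
    (Complex.differentiableOn_dslope (hD.mem_nhds haD)).2 hwN
  refine ⟨fun z => 1 - (1 - w z ^ N) ^ m,
    fun z => -(-dslope (fun z => w z ^ N) a z) ^ m, by fun_prop, by fun_prop, ?_, ?_⟩
  · intro z
    have h := sub_smul_dslope (fun z => w z ^ N) a z
    simp only [hwa haD, one_pow, smul_eq_mul] at h
    have h' : 1 - w z ^ N = (z - a) * -dslope (fun z => w z ^ N) a z := by linear_combination h
    simp only [h', mul_pow]
    ring
  · intro z hz
    have h1 : ‖w z ^ N‖ < δ := by
      rw [norm_pow]
      exact (pow_le_pow_left₀ (norm_nonneg _) (hρ z hz) N).trans_lt hN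
    have h2 := hδ' (x := w z ^ N) (by simpa using h1)
    simp only [sub_zero, one_pow, sub_self, dist_zero_right] at h2
    rw [norm_mul]
    calc ‖P z‖ * ‖1 - (1 - w z ^ N) ^ m‖ ≤ (|C| + 1) * (ε / (|C| + 1)) := by
          gcongr
          exact hC' z hz
      _ = ε := by field_simp

/-- Taylor expansion with analytic remainder. -/
theorem AnalyticAt.exists_differentiable_add_pow_mul {φ : ℂ → ℂ} {a : ℂ} (hφ : AnalyticAt ℂ φ a)
    (m : ℕ) :
    ∃ t s : ℂ → ℂ, Differentiable ℂ t ∧ AnalyticAt ℂ s a ∧ ∀ z, φ z = t z + (z - a) ^ m * s z := by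
  induction m with
  | zero => exact ⟨fun _ => 0, φ, by fun_prop, hφ, by simp⟩
  | succ m ih =>
    obtain ⟨t, s, ht, hs, h⟩ := ih
    obtain ⟨p, hp⟩ := hs
    refine ⟨fun z => t z + (z - a) ^ m * s a, dslope s a, by fun_prop,
      ⟨_, hp.has_fpower_series_dslope_fslope⟩, fun z => ?_⟩
    have h1 := sub_smul_dslope s a z
    rw [smul_eq_mul] at h1
    rw [h z]
    linear_combination -(z - a) ^ m * h1

/-- A function with a prescribed principal part at one point, small on an exhausting set. -/
theorem exists_small_with_principal_part {D : Set ℂ} (hD : IsOpen D) {f g : ℂ → ℂ} {a : ℂ}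
    (haD : a ∈ D) (hf : AnalyticAt ℂ f a) (hf0 : ∀ᶠ z in 𝓝[≠] a, f z ≠ 0)
    (hg : AnalyticAt ℂ g a) {n : ℕ} (ha : a ∉ planarExhaustion D n) {ε : ℝ} (hε : 0 < ε) :
    ∃ T q : ℂ → ℂ, DifferentiableOn ℂ T (D \ {a}) ∧ (∀ z ∈ planarExhaustion D n, ‖T z‖ ≤ ε) ∧
      AnalyticAt ℂ q a ∧ ∀ᶠ z in 𝓝[≠] a, f z * T z = g z + f z * q z := by
  have hne : ¬ ∀ᶠ z in 𝓝 a, f z = 0 := fun h => by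
    obtain ⟨z, hz1, hz2⟩ := (hf0.and (h.filter_mono nhdsWithin_le_nhds)).exists
    exact hz1 hz2
  obtain ⟨m, u, hu, hua, hfu⟩ := hf.exists_eventuallyEq_pow_smul_nonzero_iff.2 hne
  obtain ⟨t, s, ht, hs, hts⟩ := (hg.div hu hua).exists_differentiable_add_pow_mul m
  have hPd : ∀ z, z ≠ a → DifferentiableAt ℂ (fun z => t z / (z - a) ^ m) z := fun z hz => by
    have h1 : (z - a) ^ m ≠ 0 := pow_ne_zero _ (sub_ne_zero.2 hz)
    have h2 := ht z
    fun_prop (disch := assumption)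
  have hP : ContinuousOn (fun z => t z / (z - a) ^ m) (planarExhaustion D n) := fun z hz =>
    (hPd z fun h => ha (h ▸ hz)).continuousAt.continuousWithinAt
  obtain ⟨e, q, he, hq, heq, hsmall⟩ := exists_damping_factor hD haD ha hP m hε
  refine ⟨fun z => t z / (z - a) ^ m * e z, fun z => t z * q z - s z, ?_, hsmall, ?_, ?_⟩
  · intro z hz
    exact ((hPd z hz.2).differentiableWithinAt).mul ((he z hz.1).mono Set.sdiff_subset)
  · exact (ht.analyticAt a).mul (hq.analyticAt (hD.mem_nhds haD)) |>.sub hs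
  · have h1 : ∀ᶠ z in 𝓝 a, u z ≠ 0 := hu.continuousAt.eventually_ne hua
    filter_upwards [hfu.filter_mono nhdsWithin_le_nhds, h1.filter_mono nhdsWithin_le_nhds,
      self_mem_nhdsWithin] with z hz1 hz2 hz3
    have h2 : (z - a) ^ m ≠ 0 := pow_ne_zero _ (sub_ne_zero.2 hz3)
    have h3 := hts z
    simp only [Pi.div_apply] at h3
    rw [div_eq_iff hz2] at h3
    rw [hz1, h3, smul_eq_mul]
    rw [heq z]
    field_simp
    ring

theorem finite_zeros_inter_of_isCompact {K : Set ℂ} (hK : IsCompact K) {f : ℂ → ℂ}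
    (hf0 : ∀ c ∈ K, ∀ᶠ z in 𝓝[≠] c, f z ≠ 0) : {z ∈ K | f z = 0}.Finite := by
  by_contra h
  obtain ⟨x, hx, hacc⟩ :=
    Set.Infinite.exists_accPt_of_subset_isCompact h hK (fun z hz => hz.1)
  rw [accPt_iff_frequently_nhdsNE] at hacc
  obtain ⟨z, hz1, hz2⟩ := (hacc.and_eventually (hf0 x hx)).exists
  exact hz2 hz1.2

/-- Interpolation modulo a holomorphic function on a planar open set: local analytic data can be
matched by a global holomorphic function up to multiples of `f`. -/
theorem exists_analyticOnNhd_interpolation {D : Set ℂ} (hD : IsOpen D) {f : ℂ → ℂ}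
    (hf : AnalyticOnNhd ℂ f D) (hf0 : ∀ c ∈ D, ∀ᶠ z in 𝓝[≠] c, f z ≠ 0) {g : ℂ → ℂ → ℂ}
    (hg : ∀ c ∈ D, AnalyticAt ℂ (g c) c) :
    ∃ h : ℂ → ℂ, AnalyticOnNhd ℂ h D ∧ ∀ c ∈ D, ∃ q : ℂ → ℂ, AnalyticAt ℂ q c ∧
      ∀ᶠ z in 𝓝 c, h z = g c z + f z * q z := by
  classical
  let K := planarExhaustion D
  let Z : Set ℂ := {z ∈ D | f z = 0}
  have hfin : ∀ n, {z ∈ K n | f z = 0}.Finite := fun n =>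
    finite_zeros_inter_of_isCompact (isCompact_planarExhaustion D n) fun c hc =>
      hf0 c (planarExhaustion_subset D n hc)
  have hcount : Z.Countable := by
    refine (Set.countable_iUnion fun n => (hfin n).countable).mono fun z hz => ?_
    obtain ⟨n, hn⟩ := exists_planarExhaustion_mem_nhds hD hz.1
    exact Set.mem_iUnion.2 ⟨n, mem_of_mem_nhds hn, hz.2⟩
  have : Countable Z := hcount.to_subtype
  obtain ⟨ε, hε, _, hεs, -⟩ := NNReal.exists_pos_sum_of_countable one_ne_zero Z
  have hεsum : Summable fun a : Z => (ε a : ℝ) := NNReal.summable_coe.2 hεs.summable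
  have hlevel : ∀ a : Z, ∃ n, (a : ℂ) ∉ K n ∧ (a : ℂ) ∈ K (n + 1) := by
    intro a
    have hex : ∃ n, (a : ℂ) ∈ K n := by
      obtain ⟨n, hn⟩ := exists_planarExhaustion_mem_nhds hD a.2.1
      exact ⟨n, mem_of_mem_nhds hn⟩
    have h0 : Nat.find hex ≠ 0 := fun h => by
      have := Nat.find_spec hex
      rw [h] at this
      simp [K, planarExhaustion_zero] at this
    obtain ⟨k, hk⟩ := Nat.exists_eq_succ_of_ne_zero h0
    exact ⟨k, Nat.find_min hex (by omega), by simpa [hk] using Nat.find_spec hex⟩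
  choose N hN1 hN2 using hlevel
  have hT := fun a : Z => exists_small_with_principal_part hD a.2.1 (hf a a.2.1) (hf0 a a.2.1)
    (hg a a.2.1) (hN1 a) (ε := ε a) (by exact_mod_cast hε a)
  choose T q hTd hTs hq hTq using hT
  have hTan : ∀ (a : Z), ∀ c ∈ D, c ≠ a → AnalyticAt ℂ (T a) c := fun a c hc hca =>
    (hTd a).analyticAt ((hD.sdiff isClosed_singleton).mem_nhds ⟨hc, hca⟩)
  let M : ℂ → ℂ := fun z => ∑' a, T a z
  have hM : ∀ c ∈ D, ∃ (S : Finset Z) (R : ℂ → ℂ), AnalyticAt ℂ R c ∧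
      (∀ hc : c ∈ Z, (⟨c, hc⟩ : Z) ∈ S) ∧ ∀ᶠ z in 𝓝 c, M z = ∑ a ∈ S, T a z + R z := by
    intro c hc
    obtain ⟨n, hn⟩ := exists_planarExhaustion_mem_nhds hD hc
    have hSfin : {a : Z | (a : ℂ) ∈ K n}.Finite :=
      ((hfin n).preimage Subtype.val_injective.injOn).subset fun a ha => ⟨ha, a.2.2⟩
    let S := hSfin.toFinset
    have hbound : ∀ a : Z, a ∉ S → ∀ z ∈ K n, ‖T a z‖ ≤ ε a := by
      intro a ha z hz
      have hle : n ≤ N a := by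
        by_contra h
        exact ha (by simpa [S] using planarExhaustion_mono D (by omega) (hN2 a))
      exact hTs a z (planarExhaustion_mono D hle hz)
    have hεS : Summable fun a : {a // a ∉ S} => (ε a : ℝ) :=
      hεsum.comp_injective Subtype.val_injective
    refine ⟨S, fun z => ∑' a : {a // a ∉ S}, T a z, ?_, ?_, ?_⟩
    · have hd : DifferentiableOn ℂ (fun z => ∑' a : {a // a ∉ S}, T a z) (interior (K n)) := by
        refine Complex.differentiableOn_tsum_of_summable_norm hεS (fun a => ?_) isOpen_interior
          fun a z hz => hbound a a.2 z (interior_subset hz)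
        refine (hTd a).mono fun z hz => ⟨planarExhaustion_subset D n (interior_subset hz), ?_⟩
        rintro rfl
        exact a.2 (by simpa [S] using interior_subset hz)
      exact hd.analyticAt (isOpen_interior.mem_nhds (mem_interior_iff_mem_nhds.2 hn))
    · intro hcZ
      simpa [S] using mem_of_mem_nhds hn
    · filter_upwards [hn] with z hz
      have hsum : Summable fun a => T a z := by
        rw [← S.summable_compl_iff]
        exact Summable.of_norm_bounded hεS fun a => hbound a a.2 z hz
      exact (hsum.sum_add_tsum_subtype_compl S).symm
  have hloc : ∀ c ∈ D, ∃ φ r : ℂ → ℂ, AnalyticAt ℂ φ c ∧ AnalyticAt ℂ r c ∧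
      (∀ᶠ z in 𝓝[≠] c, f z * M z = φ z) ∧ ∀ᶠ z in 𝓝 c, φ z = g c z + f z * r z := by
    intro c hc
    obtain ⟨S, R, hR, hS, hMS⟩ := hM c hc
    by_cases hcZ : c ∈ Z
    · have hrest : AnalyticAt ℂ (fun z => ∑ a ∈ S.erase ⟨c, hcZ⟩, T a z) c :=
        Finset.analyticAt_fun_sum _ fun a ha => hTan a c hc fun h =>
          (Finset.mem_erase.1 ha).1 (Subtype.ext h.symm)
      refine ⟨fun z => g c z + f z * (q ⟨c, hcZ⟩ z + ∑ a ∈ S.erase ⟨c, hcZ⟩, T a z + R z),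
        fun z => q ⟨c, hcZ⟩ z + ∑ a ∈ S.erase ⟨c, hcZ⟩, T a z + R z,
        (hg c hc).add ((hf c hc).mul (((hq ⟨c, hcZ⟩).add hrest).add hR)),
        ((hq ⟨c, hcZ⟩).add hrest).add hR, ?_, Eventually.of_forall fun _ => rfl⟩
      filter_upwards [hMS.filter_mono nhdsWithin_le_nhds, hTq ⟨c, hcZ⟩] with z hz1 hz2
      rw [hz1, ← Finset.add_sum_erase _ _ (hS hcZ)]
      linear_combination hz2
    · have hfc : f c ≠ 0 := fun h => hcZ ⟨hc, h⟩
      have hsum : AnalyticAt ℂ (fun z => ∑ a ∈ S, T a z) c :=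
        Finset.analyticAt_fun_sum _ fun a _ => hTan a c hc fun h => hcZ (h ▸ a.2)
      have hφ : AnalyticAt ℂ (fun z => f z * (∑ a ∈ S, T a z + R z)) c :=
        (hf c hc).mul (hsum.add hR)
      refine ⟨fun z => f z * (∑ a ∈ S, T a z + R z),
        fun z => (f z * (∑ a ∈ S, T a z + R z) - g c z) / f z, hφ,
        (hφ.sub (hg c hc)).div (hf c hc) hfc, ?_, ?_⟩
      · filter_upwards [hMS.filter_mono nhdsWithin_le_nhds] with z hz
        rw [hz]
      · filter_upwards [(hf c hc).continuousAt.eventually_ne hfc] with z hz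
        field_simp
        ring
  choose! φ r hφ hr hφM hφg using hloc
  have hdiag := fun c hc => diagonal_eventuallyEq_of_punctured hD hφ hφM (c := c) hc
  refine ⟨fun z => φ z z, fun c hc => (hφ c hc).congr (hdiag c hc).symm,
    fun c hc => ⟨r c, hr c hc, ?_⟩⟩
  filter_upwards [hdiag c hc, hφg c hc] with z hz1 hz2
  rw [hz1, hz2]

/-- Analyticity of a function with values in the complexified quaternions. -/
def QAnalyticAt (F : ℂ → Quaternion ℂ) (a : ℂ) : Prop :=
  AnalyticAt ℂ (fun z => (F z).re) a ∧ AnalyticAt ℂ (fun z => (F z).imI) a ∧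
  AnalyticAt ℂ (fun z => (F z).imJ) a ∧ AnalyticAt ℂ (fun z => (F z).imK) a

namespace QAnalyticAt

variable {F G : ℂ → Quaternion ℂ} {a : ℂ}

theorem const (X : Quaternion ℂ) : QAnalyticAt (fun _ => X) a :=
  ⟨analyticAt_const, analyticAt_const, analyticAt_const, analyticAt_const⟩

theorem add (hF : QAnalyticAt F a) (hG : QAnalyticAt G a) :
    QAnalyticAt (fun z => F z + G z) a := by
  obtain ⟨f1, f2, f3, f4⟩ := hF
  obtain ⟨g1, g2, g3, g4⟩ := hG
  refine ⟨?_, ?_, ?_, ?_⟩ <;> simp <;> fun_prop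

theorem neg (hF : QAnalyticAt F a) : QAnalyticAt (fun z => -F z) a := by
  obtain ⟨f1, f2, f3, f4⟩ := hF
  refine ⟨?_, ?_, ?_, ?_⟩ <;> simp <;> fun_prop

theorem mul (hF : QAnalyticAt F a) (hG : QAnalyticAt G a) :
    QAnalyticAt (fun z => F z * G z) a := by
  obtain ⟨f1, f2, f3, f4⟩ := hF
  obtain ⟨g1, g2, g3, g4⟩ := hG
  refine ⟨?_, ?_, ?_, ?_⟩ <;> simp <;> fun_prop

theorem star (hF : QAnalyticAt F a) : QAnalyticAt (fun z => Star.star (F z)) a := by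
  obtain ⟨f1, f2, f3, f4⟩ := hF
  refine ⟨?_, ?_, ?_, ?_⟩ <;> simp <;> fun_prop

theorem smul {c : ℂ → ℂ} (hc : AnalyticAt ℂ c a) (hF : QAnalyticAt F a) :
    QAnalyticAt (fun z => c z • F z) a := by
  obtain ⟨f1, f2, f3, f4⟩ := hF
  refine ⟨?_, ?_, ?_, ?_⟩ <;> simp <;> fun_prop

theorem normSq (hF : QAnalyticAt F a) : AnalyticAt ℂ (fun z => Quaternion.normSq (F z)) a := by
  obtain ⟨f1, f2, f3, f4⟩ := hF
  simp only [Quaternion.normSq_def']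
  fun_prop

theorem sum {ι : Type*} (s : Finset ι) {F : ι → ℂ → Quaternion ℂ}
    (hF : ∀ i, QAnalyticAt (F i) a) : QAnalyticAt (fun z => ∑ i ∈ s, F i z) a := by
  classical
  induction s using Finset.induction_on with
  | empty => simpa using const 0
  | insert i s hi ih => simpa [Finset.sum_insert hi] using (hF i).add ih

end QAnalyticAt

theorem Quaternion.mul_complex_smul (c : ℂ) (X Y : Quaternion ℂ) : X * (c • Y) = c • (X * Y) :=
  Algebra.mul_smul_comm c X Y

theorem Quaternion.mul_inv_normSq_smul_star {X : Quaternion ℂ} (hX : Quaternion.normSq X ≠ 0) :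
    X * ((Quaternion.normSq X)⁻¹ • star X) = 1 := by
  rw [Quaternion.mul_complex_smul, Quaternion.self_mul_star, Quaternion.smul_coe,
    inv_mul_cancel₀ hX, Quaternion.coe_one]

/-- Gluing for functions with values in the complexified quaternions. -/
theorem exists_qAnalyticAt_of_punctured {D : Set ℂ} (hD : IsOpen D) {F : ℂ → Quaternion ℂ}
    {Φ : ℂ → ℂ → Quaternion ℂ} (hΦ : ∀ c ∈ D, QAnalyticAt (Φ c) c)
    (hF : ∀ c ∈ D, ∀ᶠ z in 𝓝[≠] c, F z = Φ c z) :
    ∀ c ∈ D, QAnalyticAt (fun z => Φ z z) c := by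
  intro c hc
  have key : ∀ p : Quaternion ℂ → ℂ, (∀ c ∈ D, AnalyticAt ℂ (fun z => p (Φ c z)) c) →
      AnalyticAt ℂ (fun z => p (Φ z z)) c := fun p hp =>
    (hp c hc).congr (diagonal_eventuallyEq_of_punctured hD (F := fun z => p (F z))
      (φ := fun c z => p (Φ c z)) hp
      (fun c hc => (hF c hc).mono fun z hz => by rw [hz]) hc).symm
  exact ⟨key _ fun c hc => (hΦ c hc).1, key _ fun c hc => (hΦ c hc).2.1,
    key _ fun c hc => (hΦ c hc).2.2.1, key _ fun c hc => (hΦ c hc).2.2.2⟩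

/-- Interpolation modulo a scalar function for functions with values in the complexified
quaternions. -/
theorem exists_qAnalyticAt_interpolation {D : Set ℂ} (hD : IsOpen D) {f : ℂ → ℂ}
    (hf : AnalyticOnNhd ℂ f D) (hf0 : ∀ c ∈ D, ∀ᶠ z in 𝓝[≠] c, f z ≠ 0)
    {G : ℂ → ℂ → Quaternion ℂ} (hG : ∀ c ∈ D, QAnalyticAt (G c) c) :
    ∃ H : ℂ → Quaternion ℂ, (∀ c ∈ D, QAnalyticAt H c) ∧ ∀ c ∈ D, ∃ Q : ℂ → Quaternion ℂ,
      QAnalyticAt Q c ∧ ∀ᶠ z in 𝓝 c, H z = G c z + f z • Q z := by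
  obtain ⟨h1, hh1, H1⟩ := exists_analyticOnNhd_interpolation hD hf hf0 fun c hc => (hG c hc).1
  obtain ⟨h2, hh2, H2⟩ := exists_analyticOnNhd_interpolation hD hf hf0 fun c hc => (hG c hc).2.1
  obtain ⟨h3, hh3, H3⟩ := exists_analyticOnNhd_interpolation hD hf hf0 fun c hc => (hG c hc).2.2.1
  obtain ⟨h4, hh4, H4⟩ := exists_analyticOnNhd_interpolation hD hf hf0 fun c hc => (hG c hc).2.2.2
  refine ⟨fun z => ⟨h1 z, h2 z, h3 z, h4 z⟩,
    fun c hc => ⟨hh1 c hc, hh2 c hc, hh3 c hc, hh4 c hc⟩, fun c hc => ?_⟩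
  obtain ⟨q1, hq1, e1⟩ := H1 c hc
  obtain ⟨q2, hq2, e2⟩ := H2 c hc
  obtain ⟨q3, hq3, e3⟩ := H3 c hc
  obtain ⟨q4, hq4, e4⟩ := H4 c hc
  refine ⟨fun z => ⟨q1 z, q2 z, q3 z, q4 z⟩, ⟨hq1, hq2, hq3, hq4⟩, ?_⟩
  filter_upwards [e1, e2, e3, e4] with z z1 z2 z3 z4
  exact Quaternion.ext _ _ z1 z2 z3 z4

/-- Holomorphic functions with values in the complexified quaternions generate the unit right
ideal as soon as they do so pointwise. -/
theorem exists_qAnalyticAt_sum_mul_eq_one {D : Set ℂ} (hD : IsOpen D) (hDc : IsPreconnected D)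
    {ι : Type*} [Fintype ι] {F : ι → ℂ → Quaternion ℂ} (hF : ∀ i, ∀ c ∈ D, QAnalyticAt (F i) c)
    {i₀ : ι} {x₀ : ℂ} (hx₀ : x₀ ∈ D) (hne : Quaternion.normSq (F i₀ x₀) ≠ 0)
    (hpt : ∀ c ∈ D, ∃ X : ι → Quaternion ℂ, ∑ i, F i c * X i = 1) :
    ∃ H : ι → ℂ → Quaternion ℂ, (∀ i, ∀ c ∈ D, QAnalyticAt (H i) c) ∧
      ∀ z ∈ D, ∑ i, F i z * H i z = 1 := by
  classical
  let φ : ℂ → ℂ := fun z => Quaternion.normSq (F i₀ z)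
  have hφ : AnalyticOnNhd ℂ φ D := fun c hc => (hF i₀ c hc).normSq
  have hφ0 : ∀ c ∈ D, ∀ᶠ z in 𝓝[≠] c, φ z ≠ 0 := by
    intro c hc
    by_contra h
    exact hne (hφ.eqOn_zero_of_preconnected_of_frequently_eq_zero hDc hc
      ((not_eventually.1 h).mono fun z hz => not_not.1 hz) hx₀)
  choose! X hX using hpt
  let S : ℂ → ℂ → Quaternion ℂ := fun c z => ∑ i, F i z * X c i
  have hS : ∀ c ∈ D, QAnalyticAt (S c) c := fun c hc =>
    QAnalyticAt.sum _ fun i => (hF i c hc).mul (QAnalyticAt.const _)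
  have hS1 : ∀ c ∈ D, Quaternion.normSq (S c c) ≠ 0 := fun c hc => by
    simp only [S, hX c hc, map_one]
    exact one_ne_zero
  let G : ι → ℂ → ℂ → Quaternion ℂ := fun i c z =>
    X c i * ((Quaternion.normSq (S c z))⁻¹ • star (S c z))
  have hG : ∀ i, ∀ c ∈ D, QAnalyticAt (G i c) c := fun i c hc =>
    (QAnalyticAt.const _).mul (QAnalyticAt.smul ((hS c hc).normSq.inv (hS1 c hc)) (hS c hc).star)
  have hFG : ∀ c ∈ D, ∀ᶠ z in 𝓝 c, ∑ i, F i z * G i c z = 1 := by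
    intro c hc
    filter_upwards [(hS c hc).normSq.continuousAt.eventually_ne (hS1 c hc)] with z hz
    simp only [G, ← mul_assoc, ← Finset.sum_mul]
    exact Quaternion.mul_inv_normSq_smul_star hz
  choose H hH hHG using fun i => exists_qAnalyticAt_interpolation hD hφ hφ0 (hG i)
  choose! Q hQ hHQ using hHG
  let Φ : ℂ → ℂ → Quaternion ℂ := fun c z => -∑ i, F i z * Q i c z
  have hΦ : ∀ c ∈ D, QAnalyticAt (Φ c) c := fun c hc =>
    (QAnalyticAt.sum _ fun i => (hF i c hc).mul (hQ i c hc)).neg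
  have hN : ∀ c ∈ D, ∀ᶠ z in 𝓝 c, 1 - ∑ i, F i z * H i z = φ z • Φ c z := by
    intro c hc
    filter_upwards [hFG c hc, eventually_all.2 fun i => hHQ i c hc] with z hz1 hz2
    simp only [Φ, hz2, mul_add, Finset.sum_add_distrib, hz1, smul_neg, Finset.smul_sum,
      Quaternion.mul_complex_smul]
    abel
  have hglue := exists_qAnalyticAt_of_punctured hD
    (F := fun z => (φ z)⁻¹ • (1 - ∑ i, F i z * H i z)) hΦ (fun c hc => by
      filter_upwards [(hN c hc).filter_mono nhdsWithin_le_nhds, hφ0 c hc] with z hz1 hz2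
      rw [hz1, inv_smul_smul₀ hz2])
  refine ⟨fun i z => H i z + if i = i₀ then star (F i₀ z) * Φ z z else 0, fun i c hc => ?_,
    fun z hz => ?_⟩
  · refine (hH i c hc).add ?_
    split_ifs
    · exact (hF i₀ c hc).star.mul (hglue c hc)
    · exact QAnalyticAt.const 0
  · have h1 : F i₀ z * (star (F i₀ z) * Φ z z) = φ z • Φ z z := by
      rw [← mul_assoc, Quaternion.self_mul_star, Quaternion.coe_mul_eq_smul]
    simp only [mul_add, mul_ite, mul_zero, Finset.sum_add_distrib, Finset.sum_ite_eq',
      Finset.mem_univ, if_true, h1, ← (hN z hz).self_of_nhds]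
    abel

/-- The element `α + iβ` of the complexified quaternions. -/
def complexify (α β : Quaternion ℝ) : Quaternion ℂ :=
  ⟨⟨α.re, β.re⟩, ⟨α.imI, β.imI⟩, ⟨α.imJ, β.imJ⟩, ⟨α.imK, β.imK⟩⟩

@[simp] theorem complexify_re (α β : Quaternion ℝ) :
    (complexify α β).re = ⟨α.re, β.re⟩ := rfl

@[simp] theorem complexify_imI (α β : Quaternion ℝ) :
    (complexify α β).imI = ⟨α.imI, β.imI⟩ := rfl

@[simp] theorem complexify_imJ (α β : Quaternion ℝ) :
    (complexify α β).imJ = ⟨α.imJ, β.imJ⟩ := rfl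

@[simp] theorem complexify_imK (α β : Quaternion ℝ) :
    (complexify α β).imK = ⟨α.imK, β.imK⟩ := rfl

/-- The component `α` of `α + iβ`. -/
def stemRe (X : Quaternion ℂ) : Quaternion ℝ := ⟨X.re.re, X.imI.re, X.imJ.re, X.imK.re⟩

/-- The component `β` of `α + iβ`. -/
def stemIm (X : Quaternion ℂ) : Quaternion ℝ := ⟨X.re.im, X.imI.im, X.imJ.im, X.imK.im⟩

@[simp] theorem stemRe_re (X : Quaternion ℂ) : (stemRe X).re = X.re.re := rfl

@[simp] theorem stemRe_imI (X : Quaternion ℂ) : (stemRe X).imI = X.imI.re := rfl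

@[simp] theorem stemRe_imJ (X : Quaternion ℂ) : (stemRe X).imJ = X.imJ.re := rfl

@[simp] theorem stemRe_imK (X : Quaternion ℂ) : (stemRe X).imK = X.imK.re := rfl

@[simp] theorem stemIm_re (X : Quaternion ℂ) : (stemIm X).re = X.re.im := rfl

@[simp] theorem stemIm_imI (X : Quaternion ℂ) : (stemIm X).imI = X.imI.im := rfl

@[simp] theorem stemIm_imJ (X : Quaternion ℂ) : (stemIm X).imJ = X.imJ.im := rfl

@[simp] theorem stemIm_imK (X : Quaternion ℂ) : (stemIm X).imK = X.imK.im := rfl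

theorem complexify_stemRe_stemIm (X : Quaternion ℂ) :
    complexify (stemRe X) (stemIm X) = X := rfl

theorem complexify_mul (α β γ δ : Quaternion ℝ) :
    complexify α β * complexify γ δ = complexify (α * γ - β * δ) (α * δ + β * γ) := by
  ext <;> apply Complex.ext <;> simp <;> ring

theorem complexify_add (α β γ δ : Quaternion ℝ) :
    complexify α β + complexify γ δ = complexify (α + γ) (β + δ) := by
  ext <;> apply Complex.ext <;> simp

theorem complexify_one_zero : complexify 1 0 = 1 := rfl

theorem complexify_zero_zero : complexify 0 0 = 0 := rfl

theorem complexify_sum {ι : Type*} (s : Finset ι) (α β : ι → Quaternion ℝ) :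
    ∑ i ∈ s, complexify (α i) (β i) = complexify (∑ i ∈ s, α i) (∑ i ∈ s, β i) := by
  classical
  induction s using Finset.induction_on with
  | empty => simp [complexify_zero_zero]
  | insert i s hi ih => simp [Finset.sum_insert hi, ih, complexify_add]

theorem complexify_injective {α β γ δ : Quaternion ℝ} (h : complexify α β = complexify γ δ) :
    α = γ ∧ β = δ :=
  ⟨congrArg stemRe h, congrArg stemIm h⟩

theorem normSq_complexify (α β : Quaternion ℝ) :
    Quaternion.normSq (complexify α β) =
      ⟨Quaternion.normSq α - Quaternion.normSq β, 2 * (α * star β).re⟩ := by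
  apply Complex.ext <;> simp [Quaternion.normSq_def', pow_two] <;> ring

theorem neg_mem_QSphere {I : Quaternion ℝ} (hI : I ∈ QSphere) : -I ∈ QSphere := by
  have : I ^ 2 = -1 := hI
  change (-I) ^ 2 = -1
  rw [neg_sq, this]

theorem mul_self_of_mem_QSphere {I : Quaternion ℝ} (hI : I ∈ QSphere) : I * I = -1 := by
  rw [← pow_two]
  exact hI

/-- The first standard imaginary unit. -/
def unitI : Quaternion ℝ := ⟨0, 1, 0, 0⟩

@[simp] theorem unitI_re : unitI.re = 0 := rfl

@[simp] theorem unitI_imI : unitI.imI = 1 := rfl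

@[simp] theorem unitI_imJ : unitI.imJ = 0 := rfl

@[simp] theorem unitI_imK : unitI.imK = 0 := rfl

/-- The second standard imaginary unit. -/
def unitJ : Quaternion ℝ := ⟨0, 0, 1, 0⟩

@[simp] theorem unitJ_re : unitJ.re = 0 := rfl

@[simp] theorem unitJ_imI : unitJ.imI = 0 := rfl

@[simp] theorem unitJ_imJ : unitJ.imJ = 1 := rfl

@[simp] theorem unitJ_imK : unitJ.imK = 0 := rfl

/-- The third standard imaginary unit. -/
def unitK : Quaternion ℝ := ⟨0, 0, 0, 1⟩

@[simp] theorem unitK_re : unitK.re = 0 := rfl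

@[simp] theorem unitK_imI : unitK.imI = 0 := rfl

@[simp] theorem unitK_imJ : unitK.imJ = 0 := rfl

@[simp] theorem unitK_imK : unitK.imK = 1 := rfl

theorem unitI_mem_QSphere : unitI ∈ QSphere := by
  change unitI ^ 2 = -1
  rw [pow_two]
  ext <;> simp <;> rfl

/-- A complexified quaternion `α + iβ` of vanishing norm with `β ≠ 0` determines an imaginary
unit `I` with `α + Iβ = 0`. -/
theorem neg_mul_inv_mem_QSphere {α β : Quaternion ℝ} (hβ : β ≠ 0)
    (h : Quaternion.normSq (complexify α β) = 0) : -(α * β⁻¹) ∈ QSphere := by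
  rw [normSq_complexify] at h
  have h1 : Quaternion.normSq α - Quaternion.normSq β = 0 := congrArg Complex.re h
  have h2 : 2 * (α * star β).re = 0 := congrArg Complex.im h
  apply neg_mem_QSphere
  change (α * β⁻¹) ^ 2 = -1
  have hβ' : Quaternion.normSq β ≠ 0 := Quaternion.normSq_ne_zero.2 hβ
  have hre : (α * β⁻¹).re = 0 := by
    rw [Quaternion.inv_def, mul_smul_comm, Quaternion.re_smul]
    simp only [smul_eq_mul]
    rw [show (α * star β).re = 0 by linarith, mul_zero]
  rw [Quaternion.sq_eq_neg_normSq.2 hre, map_mul, Quaternion.normSq_inv,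
    show Quaternion.normSq α = Quaternion.normSq β by linarith, mul_inv_cancel₀ hβ']
  simp

/-- If no imaginary unit is a common zero of `α i + Iβ i`, then the elements `α i + iβ i`
generate the unit right ideal of the complexified quaternions. -/
theorem exists_sum_complexify_mul_eq_one {ι : Type*} [Fintype ι] (α β : ι → Quaternion ℝ)
    (h : ∀ I ∈ QSphere, ∃ i, α i + I * β i ≠ 0) :
    ∃ X : ι → Quaternion ℂ, ∑ i, complexify (α i) (β i) * X i = 1 := by
  classical
  by_cases hN : ∃ i, Quaternion.normSq (complexify (α i) (β i)) ≠ 0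
  · obtain ⟨i, hi⟩ := hN
    refine ⟨fun j => if j = i then
      (Quaternion.normSq (complexify (α i) (β i)))⁻¹ • star (complexify (α i) (β i)) else 0, ?_⟩
    simp only [mul_ite, mul_zero, Finset.sum_ite_eq', Finset.mem_univ, if_true]
    exact Quaternion.mul_inv_normSq_smul_star hi
  push Not at hN
  obtain ⟨k, hk⟩ : ∃ k, β k ≠ 0 := by
    by_contra hβ
    push Not at hβ
    obtain ⟨i, hi⟩ := h _ unitI_mem_QSphere
    have h1 : Quaternion.normSq (α i) - Quaternion.normSq (β i) = 0 := by
      have := hN i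
      rw [normSq_complexify] at this
      exact congrArg Complex.re this
    rw [hβ i, map_zero, sub_zero, Quaternion.normSq_eq_zero] at h1
    exact hi (by rw [h1, hβ i, mul_zero, add_zero])
  have hI := neg_mul_inv_mem_QSphere hk (hN k)
  set I := -(α k * (β k)⁻¹) with hIdef
  obtain ⟨l, hl⟩ := h I hI
  set p := α l + I * β l with hp
  have hII := mul_self_of_mem_QSphere hI
  have hidem : complexify (α k) (β k) * complexify 0 (-((2⁻¹ : ℝ) • (β k)⁻¹)) =
      complexify ((2⁻¹ : ℝ) • 1) ((2⁻¹ : ℝ) • I) := by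
    rw [complexify_mul, hIdef]
    congr 1
    · simp [mul_inv_cancel₀ hk]
    · simp
  have hA : α l * p⁻¹ = 1 - I * (β l * p⁻¹) := by
    rw [eq_sub_iff_add_eq, ← mul_assoc, ← add_mul, mul_inv_cancel₀ hl]
  have hfin : complexify (α l) (β l) * complexify p⁻¹ 0 +
      complexify (α k) (β k) * (complexify 0 (-((2⁻¹ : ℝ) • (β k)⁻¹)) *
        complexify (1 - α l * p⁻¹) (-(β l * p⁻¹))) = 1 := by
    rw [← mul_assoc, hidem, complexify_mul, complexify_mul, complexify_add, ← complexify_one_zero]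
    have hhalf : ∀ x : Quaternion ℝ, (2⁻¹ : ℝ) • x + (2⁻¹ : ℝ) • x = x := fun x => by
      rw [← add_smul]
      norm_num
    congr 1
    · simp only [mul_zero, sub_zero, smul_mul_assoc, one_mul, mul_neg, hA, sub_sub_cancel,
        sub_neg_eq_add, hhalf]
      abel
    · have : I * (I * (β l * p⁻¹)) = -(β l * p⁻¹) := by rw [← mul_assoc, hII, neg_one_mul]
      simp only [mul_zero, zero_add, smul_mul_assoc, one_mul, mul_neg, hA, sub_sub_cancel,
        smul_neg, this]
      rw [← sub_eq_add_neg, ← neg_add', hhalf, add_neg_cancel]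
  refine ⟨fun j => (if j = l then complexify p⁻¹ 0 else 0) + if j = k then
    complexify 0 (-((2⁻¹ : ℝ) • (β k)⁻¹)) * complexify (1 - α l * p⁻¹) (-(β l * p⁻¹)) else 0, ?_⟩
  simpa only [mul_add, mul_ite, mul_zero, Finset.sum_add_distrib, Finset.sum_ite_eq',
    Finset.mem_univ, if_true] using hfin

theorem differentiableAt_complex_mk {α β : ℂ → Quaternion ℝ} {α' β' : ℂ →L[ℝ] Quaternion ℝ}
    {z : ℂ} (hα : HasFDerivAt α α' z) (hβ : HasFDerivAt β β' z) (h1 : β' Complex.I = α' 1)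
    (hI : α' Complex.I = -β' 1) (L : Quaternion ℝ →ₗ[ℝ] ℝ) :
    DifferentiableAt ℂ (fun z => (⟨L (α z), L (β z)⟩ : ℂ)) z := by
  let L' := LinearMap.toContinuousLinearMap L
  have h : HasFDerivAt (fun z => (⟨L (α z), L (β z)⟩ : ℂ))
      ((Complex.equivRealProdCLM.symm : ℝ × ℝ →L[ℝ] ℂ).comp
        ((L'.comp α').prod (L'.comp β'))) z :=
    (Complex.equivRealProdCLM.symm : ℝ × ℝ →L[ℝ] ℂ).hasFDerivAt.comp z
      ((L'.hasFDerivAt.comp z hα).prodMk (L'.hasFDerivAt.comp z hβ))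
  refine differentiableAt_complex_iff_differentiableAt_real.2 ⟨h.differentiableAt, ?_⟩
  rw [h.fderiv]
  apply Complex.ext <;> simp [h1, hI]

/-- The Cauchy–Riemann equations for functions with values in the complexified quaternions. -/
theorem qAnalyticAt_complexify {D : Set ℂ} (hD : IsOpen D) {α β : ℂ → Quaternion ℝ}
    (h : ∀ z ∈ D, ∃ α' β' : ℂ →L[ℝ] Quaternion ℝ, HasFDerivAt α α' z ∧ HasFDerivAt β β' z ∧
      β' Complex.I = α' 1 ∧ α' Complex.I = -β' 1) {c : ℂ} (hc : c ∈ D) :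
    QAnalyticAt (fun z => complexify (α z) (β z)) c := by
  have key : ∀ L : Quaternion ℝ →ₗ[ℝ] ℝ,
      AnalyticAt ℂ (fun z => (⟨L (α z), L (β z)⟩ : ℂ)) c := by
    intro L
    refine DifferentiableOn.analyticAt (s := D) (fun z hz => ?_) (hD.mem_nhds hc)
    obtain ⟨α', β', hα, hβ, h1, hI⟩ := h z hz
    exact (differentiableAt_complex_mk hα hβ h1 hI L).differentiableWithinAt
  exact ⟨key (QuaternionAlgebra.reₗ _ _ _), key (QuaternionAlgebra.imIₗ _ _ _),
    key (QuaternionAlgebra.imJₗ _ _ _), key (QuaternionAlgebra.imKₗ _ _ _)⟩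

/-- The planar set underlying an axially symmetric set. -/
def planarSet (Ω : Set (Quaternion ℝ)) : Set ℂ :=
  {z | (z.re : Quaternion ℝ) + (z.im : Quaternion ℝ) * unitI ∈ Ω}

theorem isOpen_planarSet {Ω : Set (Quaternion ℝ)} (hΩ : IsOpen Ω) : IsOpen (planarSet Ω) := by
  refine hΩ.preimage ?_
  have h1 : Continuous fun z : ℂ => (z.re : Quaternion ℝ) :=
    Quaternion.continuous_coe.comp Complex.continuous_re
  have h2 : Continuous fun z : ℂ => (z.im : Quaternion ℝ) :=
    Quaternion.continuous_coe.comp Complex.continuous_im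
  exact h1.add (h2.mul continuous_const)

theorem isPreconnected_planarSet {Ω : Set (Quaternion ℝ)}
    (hΩ : IsPreconnected (Ω ∩ sliceL unitI)) : IsPreconnected (planarSet Ω) := by
  have hcont : Continuous fun q : Quaternion ℝ => (⟨q.re, q.imI⟩ : ℂ) :=
    Complex.equivRealProdCLM.symm.continuous.comp
      (Quaternion.continuous_re.prodMk Quaternion.continuous_imI)
  have himage : planarSet Ω =
      (fun q : Quaternion ℝ => (⟨q.re, q.imI⟩ : ℂ)) '' (Ω ∩ sliceL unitI) := by
    ext z
    constructor
    · intro hz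
      refine ⟨_, ⟨hz, z.re, z.im, rfl⟩, ?_⟩
      apply Complex.ext <;> simp
    · rintro ⟨q, ⟨hq, x, y, rfl⟩, rfl⟩
      simpa [planarSet] using hq
  rw [himage]
  exact hΩ.image _ hcont.continuousOn

theorem slice_mem_of_mem_planarSet {Ω : Set (Quaternion ℝ)} (hΩ : IsSymmSliceDomain Ω)
    {I : Quaternion ℝ} (hI : I ∈ QSphere) {x y : ℝ} (h : (⟨x, y⟩ : ℂ) ∈ planarSet Ω) :
    (x : Quaternion ℝ) + (y : Quaternion ℝ) * I ∈ Ω :=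
  hΩ.2.2.2.2 x y unitI unitI_mem_QSphere h I hI

theorem mem_planarSet_of_slice_mem {Ω : Set (Quaternion ℝ)} (hΩ : IsSymmSliceDomain Ω)
    {I : Quaternion ℝ} (hI : I ∈ QSphere) {x y : ℝ}
    (h : (x : Quaternion ℝ) + (y : Quaternion ℝ) * I ∈ Ω) : (⟨x, y⟩ : ℂ) ∈ planarSet Ω :=
  hΩ.2.2.2.2 x y I hI h unitI unitI_mem_QSphere

theorem conj_mem_planarSet {Ω : Set (Quaternion ℝ)} (hΩ : IsSymmSliceDomain Ω) {z : ℂ}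
    (hz : z ∈ planarSet Ω) : (starRingEnd ℂ) z ∈ planarSet Ω := by
  have h := slice_mem_of_mem_planarSet hΩ (neg_mem_QSphere unitI_mem_QSphere) hz
  change ((z.re : Quaternion ℝ) + ((-z.im : ℝ) : Quaternion ℝ) * unitI) ∈ Ω
  simpa using h

/-- The stem function of `f`, computed on the slice `L_I`. -/
def stemOf (f : Quaternion ℝ → Quaternion ℝ) (I : Quaternion ℝ) (z : ℂ) : Quaternion ℂ :=
  complexify ((2⁻¹ : ℝ) • (sliceMap f I (z.re, z.im) + sliceMap f I (z.re, -z.im)))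
    (-(2⁻¹ : ℝ) • (I * (sliceMap f I (z.re, z.im) - sliceMap f I (z.re, -z.im))))

theorem qAnalyticAt_stemOf {Ω : Set (Quaternion ℝ)} (hΩ : IsSymmSliceDomain Ω)
    {f : Quaternion ℝ → Quaternion ℝ} {I : Quaternion ℝ} (hI : I ∈ QSphere)
    (hf : HoloSlice f I Ω) {c : ℂ} (hc : c ∈ planarSet Ω) : QAnalyticAt (stemOf f I) c := by
  refine qAnalyticAt_complexify (isOpen_planarSet hΩ.1) (fun z hz => ?_) hc
  obtain ⟨hd, hcr⟩ := hf z.re z.im (slice_mem_of_mem_planarSet hΩ hI hz)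
  obtain ⟨hd', hcr'⟩ := hf z.re (-z.im)
    (slice_mem_of_mem_planarSet hΩ hI (conj_mem_planarSet hΩ hz))
  have hII := mul_self_of_mem_QSphere hI
  let P : ℂ →L[ℝ] ℝ × ℝ := Complex.reCLM.prod Complex.imCLM
  let P' : ℂ →L[ℝ] ℝ × ℝ := Complex.reCLM.prod (-Complex.imCLM)
  have hs := (hd.differentiableAt (by norm_num)).hasFDerivAt
  have hs' := (hd'.differentiableAt (by norm_num)).hasFDerivAt
  set S := fderiv ℝ (sliceMap f I) (z.re, z.im)
  set S' := fderiv ℝ (sliceMap f I) (z.re, -z.im)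
  have h : HasFDerivAt (fun z : ℂ => sliceMap f I (z.re, z.im)) (S.comp P) z :=
    HasFDerivAt.comp (g := sliceMap f I) (f := P) z hs P.hasFDerivAt
  have h' : HasFDerivAt (fun z : ℂ => sliceMap f I (z.re, -z.im)) (S'.comp P') z :=
    HasFDerivAt.comp (g := sliceMap f I) (f := P') z hs' P'.hasFDerivAt
  let M : Quaternion ℝ →L[ℝ] Quaternion ℝ := ContinuousLinearMap.mul ℝ (Quaternion ℝ) I
  have hM' : HasFDerivAt
      (fun z : ℂ => I * (sliceMap f I (z.re, z.im) - sliceMap f I (z.re, -z.im)))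
      (M.comp (S.comp P - S'.comp P')) z := M.hasFDerivAt.comp z (h.sub h')
  have hA : HasFDerivAt (fun z : ℂ => sliceMap f I (z.re, z.im) + sliceMap f I (z.re, -z.im))
      (S.comp P + S'.comp P') z := h.add h'
  refine ⟨(2⁻¹ : ℝ) • (S.comp P + S'.comp P'), -(2⁻¹ : ℝ) • M.comp (S.comp P - S'.comp P'),
    hA.const_smul (2⁻¹ : ℝ), hM'.const_smul (-(2⁻¹ : ℝ)), ?_, ?_⟩
  all_goals
    have e1 : S (1, 0) = -(I * S (0, 1)) := eq_neg_of_add_eq_zero_left hcr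
    have e1' : S' (1, 0) = -(I * S' (0, 1)) := eq_neg_of_add_eq_zero_left hcr'
    have e2 : S' (0, -1) = -S' (0, 1) := by
      rw [← map_neg]
      simp
    have p1 : P 1 = (1, 0) := by simp [P]
    have pI : P Complex.I = (0, 1) := by simp [P]
    have p1' : P' 1 = (1, 0) := by simp [P']
    have pI' : P' Complex.I = (0, -1) := by simp [P']
    have hM : ∀ x, M x = I * x := fun x => rfl
    have hIIx : ∀ x, I * (I * x) = -x := fun x => by rw [← mul_assoc, hII, neg_one_mul]
    simp only [smul_apply, add_apply, sub_apply, ContinuousLinearMap.comp_apply, p1, pI, p1', pI',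
      e1, e1', e2, hM, mul_sub, mul_neg, hIIx]
    module

theorem frequently_im_eq_zero (x : ℝ) : ∃ᶠ z in 𝓝[≠] (x : ℂ), z.im = 0 := by
  have h : Tendsto (fun t : ℝ => (t : ℂ)) (𝓝[≠] x) (𝓝[≠] (x : ℂ)) := by
    refine tendsto_nhdsWithin_of_tendsto_nhds_of_eventually_within _
      ((Complex.continuous_ofReal.tendsto x).mono_left nhdsWithin_le_nhds) ?_
    filter_upwards [self_mem_nhdsWithin] with t ht
    simpa using ht
  exact h.frequently (Eventually.of_forall fun t => Complex.ofReal_im t).frequently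

theorem stemOf_of_im_eq_zero (f : Quaternion ℝ → Quaternion ℝ) (I : Quaternion ℝ) {z : ℂ}
    (hz : z.im = 0) : stemOf f I z = complexify (f z.re) 0 := by
  have h : (2⁻¹ : ℝ) • (f z.re + f z.re) = f z.re := by module
  simp [stemOf, sliceMap, hz, h]

/-- The stem function does not depend on the slice. -/
theorem stemOf_eq_stemOf_unitI {Ω : Set (Quaternion ℝ)} (hΩ : IsSymmSliceDomain Ω)
    {f : Quaternion ℝ → Quaternion ℝ} (hf : SliceRegularOn f Ω) {I : Quaternion ℝ}
    (hI : I ∈ QSphere) {z : ℂ} (hz : z ∈ planarSet Ω) : stemOf f I z = stemOf f unitI z := by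
  obtain ⟨x, hx⟩ := hΩ.2.2.1
  have hx' : (x : ℂ) ∈ planarSet Ω := by simpa [planarSet] using hx
  have hpre := isPreconnected_planarSet (hΩ.2.2.2.1 unitI unitI_mem_QSphere).isPreconnected
  have key : ∀ p : Quaternion ℂ → ℂ,
      (∀ J ∈ QSphere, AnalyticOnNhd ℂ (fun z => p (stemOf f J z)) (planarSet Ω)) →
      p (stemOf f I z) = p (stemOf f unitI z) := by
    intro p hp
    refine (hp I hI).eqOn_of_preconnected_of_frequently_eq (hp unitI unitI_mem_QSphere) hpre hx'
      ((frequently_im_eq_zero x).mono fun w hw => ?_) hz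
    simp only [stemOf_of_im_eq_zero f _ hw]
  have han : ∀ J ∈ QSphere, ∀ c ∈ planarSet Ω, QAnalyticAt (stemOf f J) c := fun J hJ c hc =>
    qAnalyticAt_stemOf hΩ hJ (hf J hJ) hc
  exact Quaternion.ext _ _ (key _ fun J hJ c hc => (han J hJ c hc).1)
    (key _ fun J hJ c hc => (han J hJ c hc).2.1) (key _ fun J hJ c hc => (han J hJ c hc).2.2.1)
    (key _ fun J hJ c hc => (han J hJ c hc).2.2.2)

/-- The representation formula for slice regular functions. -/
theorem slice_eq_stemRe_add_mul_stemIm {Ω : Set (Quaternion ℝ)} (hΩ : IsSymmSliceDomain Ω)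
    {f : Quaternion ℝ → Quaternion ℝ} (hf : SliceRegularOn f Ω) {I : Quaternion ℝ}
    (hI : I ∈ QSphere) {x y : ℝ} (hz : (⟨x, y⟩ : ℂ) ∈ planarSet Ω) :
    f ((x : Quaternion ℝ) + (y : Quaternion ℝ) * I) =
      stemRe (stemOf f unitI ⟨x, y⟩) + I * stemIm (stemOf f unitI ⟨x, y⟩) := by
  rw [← stemOf_eq_stemOf_unitI hΩ hf hI hz]
  change sliceMap f I (x, y) = (2⁻¹ : ℝ) • (sliceMap f I (x, y) + sliceMap f I (x, -y)) +
    I * (-(2⁻¹ : ℝ) • (I * (sliceMap f I (x, y) - sliceMap f I (x, -y))))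
  rw [mul_smul_comm, ← mul_assoc, mul_self_of_mem_QSphere hI, neg_one_mul]
  module

/-- The conjugation `α + iβ ↦ α - iβ` of the complexified quaternions. -/
def stemConj (X : Quaternion ℂ) : Quaternion ℂ := complexify (stemRe X) (-stemIm X)

theorem stemConj_mul (X Y : Quaternion ℂ) : stemConj (X * Y) = stemConj X * stemConj Y := by
  rw [← complexify_stemRe_stemIm X, ← complexify_stemRe_stemIm Y, complexify_mul]
  change complexify _ _ = complexify _ _ * complexify _ _
  rw [complexify_mul]
  congr 1
  · change stemRe X * stemRe Y - stemIm X * stemIm Y =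
      stemRe X * stemRe Y - -stemIm X * -stemIm Y
    rw [neg_mul_neg]
  · change -(stemRe X * stemIm Y + stemIm X * stemRe Y) =
      stemRe X * -stemIm Y + -stemIm X * stemRe Y
    rw [mul_neg, neg_mul, neg_add]

theorem stemConj_add (X Y : Quaternion ℂ) : stemConj (X + Y) = stemConj X + stemConj Y := by
  ext <;> apply Complex.ext <;> simp [stemConj] <;> ring

theorem stemConj_real_smul (r : ℝ) (X : Quaternion ℂ) :
    stemConj ((r : ℂ) • X) = (r : ℂ) • stemConj X := by
  ext <;> apply Complex.ext <;> simp [stemConj]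

theorem stemConj_zero : stemConj 0 = 0 := by
  change complexify 0 (-0) = 0
  rw [neg_zero, complexify_zero_zero]

theorem stemConj_one : stemConj 1 = 1 := by
  change complexify 1 (-0) = 1
  rw [neg_zero, complexify_one_zero]

theorem stemConj_sum {ι : Type*} (s : Finset ι) (X : ι → Quaternion ℂ) :
    stemConj (∑ i ∈ s, X i) = ∑ i ∈ s, stemConj (X i) := by
  classical
  induction s using Finset.induction_on with
  | empty => simp [stemConj_zero]
  | insert i s hi ih => simp [Finset.sum_insert hi, ih, stemConj_add]

theorem stemConj_stemConj (X : Quaternion ℂ) : stemConj (stemConj X) = X := by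
  ext <;> apply Complex.ext <;> simp [stemConj]

theorem stemConj_stemOf (f : Quaternion ℝ → Quaternion ℝ) (I : Quaternion ℝ) (z : ℂ) :
    stemConj (stemOf f I (starRingEnd ℂ z)) = stemOf f I z := by
  simp only [stemOf, Complex.conj_re, Complex.conj_im, neg_neg]
  change complexify ((2⁻¹ : ℝ) • (_ + _)) (-(-(2⁻¹ : ℝ) • (I * (_ - _)))) = _
  congr 1
  · rw [add_comm]
  · rw [← smul_neg, ← mul_neg, neg_sub]

theorem AnalyticAt.conj_comp_conj {c : ℂ → ℂ} {a : ℂ}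
    (h : AnalyticAt ℂ c (starRingEnd ℂ a)) :
    AnalyticAt ℂ (fun z => starRingEnd ℂ (c (starRingEnd ℂ z))) a := by
  rw [Complex.analyticAt_iff_eventually_differentiableAt] at h ⊢
  filter_upwards [Complex.continuous_conj.continuousAt.eventually h] with z hz
  have := hz.conj_conj
  rwa [Complex.conj_conj] at this

theorem QAnalyticAt.stemConj_comp_conj {H : ℂ → Quaternion ℂ} {a : ℂ}
    (h : QAnalyticAt H (starRingEnd ℂ a)) :
    QAnalyticAt (fun z => stemConj (H (starRingEnd ℂ z))) a :=
  ⟨h.1.conj_comp_conj, h.2.1.conj_comp_conj, h.2.2.1.conj_comp_conj, h.2.2.2.conj_comp_conj⟩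

/-- A solution of `∑ i, F i * H i = 1` can be symmetrized if all `F i` are stem functions. -/
theorem exists_symmetric_solution {D : Set ℂ} (hD : ∀ z ∈ D, starRingEnd ℂ z ∈ D)
    {ι : Type*} [Fintype ι] {F H : ι → ℂ → Quaternion ℂ}
    (hF : ∀ i z, stemConj (F i (starRingEnd ℂ z)) = F i z)
    (hH : ∀ i, ∀ c ∈ D, QAnalyticAt (H i) c) (hFH : ∀ z ∈ D, ∑ i, F i z * H i z = 1) :
    ∃ G : ι → ℂ → Quaternion ℂ, (∀ i, ∀ c ∈ D, QAnalyticAt (G i) c) ∧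
      (∀ z ∈ D, ∑ i, F i z * G i z = 1) ∧
      ∀ i z, stemConj (G i (starRingEnd ℂ z)) = G i z := by
  refine ⟨fun i z => ((2⁻¹ : ℝ) : ℂ) • (H i z + stemConj (H i (starRingEnd ℂ z))),
    fun i c hc => QAnalyticAt.smul analyticAt_const
      ((hH i c hc).add (hH i _ (hD c hc)).stemConj_comp_conj), fun z hz => ?_, fun i z => ?_⟩
  · have h2 : ∑ i, F i z * stemConj (H i (starRingEnd ℂ z)) = 1 := by
      rw [← stemConj_one, ← hFH _ (hD z hz), stemConj_sum]
      exact Finset.sum_congr rfl fun i _ => by rw [stemConj_mul, hF]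
    simp only [Quaternion.mul_complex_smul, mul_add]
    rw [← Finset.smul_sum, Finset.sum_add_distrib, hFH z hz, h2, ← two_smul ℂ (1 : Quaternion ℂ),
      smul_smul]
    norm_num
  · rw [stemConj_real_smul, stemConj_add, stemConj_stemConj, Complex.conj_conj, add_comm]

theorem re_eq_zero_and_norm_eq_one_of_mem_QSphere {J : Quaternion ℝ} (hJ : J ∈ QSphere) :
    J.re = 0 ∧ ‖J‖ = 1 := by
  have h : J ^ 2 = -1 := hJ
  have hn : ‖J‖ = 1 := by
    have h1 : ‖J‖ ^ 2 = 1 := by rw [← norm_pow, h, norm_neg, norm_one]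
    nlinarith [norm_nonneg J]
  refine ⟨Quaternion.sq_eq_neg_normSq.1 ?_, hn⟩
  rw [h, Quaternion.normSq_eq_norm_mul_self, hn]
  simp

theorem inv_norm_smul_mem_QSphere {v : Quaternion ℝ} (hre : v.re = 0) (hv : v ≠ 0) :
    ‖v‖⁻¹ • v ∈ QSphere := by
  change (‖v‖⁻¹ • v) ^ 2 = -1
  have hn : ‖v‖ ≠ 0 := norm_ne_zero_iff.2 hv
  rw [Quaternion.sq_eq_neg_normSq.2 (by simp [hre]), Quaternion.normSq_eq_norm_mul_self, norm_smul,
    norm_inv, norm_norm, inv_mul_cancel₀ hn]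
  simp

theorem exists_eq_add_mul_mem_QSphere (q : Quaternion ℝ) :
    ∃ x y : ℝ, ∃ I ∈ QSphere, q = (x : Quaternion ℝ) + (y : Quaternion ℝ) * I := by
  by_cases h : q.im = 0
  · refine ⟨q.re, 0, unitI, unitI_mem_QSphere, ?_⟩
    rw [← Quaternion.re_add_im q, h]
    simp
  · refine ⟨q.re, ‖q.im‖, _, inv_norm_smul_mem_QSphere (Quaternion.re_im q) h, ?_⟩
    rw [Quaternion.coe_mul_eq_smul, smul_inv_smul₀ (norm_ne_zero_iff.2 h), Quaternion.re_add_im]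

/-- The slice function induced by a stem function. -/
def sliceOf (G : ℂ → Quaternion ℂ) (q : Quaternion ℝ) : Quaternion ℝ :=
  stemRe (G ⟨q.re, ‖q.im‖⟩) + (‖q.im‖⁻¹ • q.im) * stemIm (G ⟨q.re, ‖q.im‖⟩)

theorem sliceOf_slice {G : ℂ → Quaternion ℂ}
    (hG : ∀ z, stemConj (G (starRingEnd ℂ z)) = G z) {J : Quaternion ℝ} (hJ : J ∈ QSphere)
    (x y : ℝ) : sliceOf G ((x : Quaternion ℝ) + (y : Quaternion ℝ) * J) =
      stemRe (G ⟨x, y⟩) + J * stemIm (G ⟨x, y⟩) := by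
  obtain ⟨hre, hn⟩ := re_eq_zero_and_norm_eq_one_of_mem_QSphere hJ
  have hqre : ((x : Quaternion ℝ) + (y : Quaternion ℝ) * J).re = x := by simp [hre]
  have hqim : ((x : Quaternion ℝ) + (y : Quaternion ℝ) * J).im = y • J := by
    rw [Quaternion.coe_mul_eq_smul]
    ext <;> simp [hre]
  have hnorm : ‖y • J‖ = |y| := by rw [norm_smul, hn, mul_one, Real.norm_eq_abs]
  rw [sliceOf, hqre, hqim, hnorm]
  rcases lt_trichotomy y 0 with hy | hy | hy
  · have hc : (starRingEnd ℂ) ⟨x, -y⟩ = (⟨x, y⟩ : ℂ) := by apply Complex.ext <;> simp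
    have h1 : stemRe (G ⟨x, -y⟩) = stemRe (G ⟨x, y⟩) := by
      rw [← hG ⟨x, -y⟩, hc]
      rfl
    have h2 : stemIm (G ⟨x, -y⟩) = -stemIm (G ⟨x, y⟩) := by
      rw [← hG ⟨x, -y⟩, hc]
      rfl
    rw [abs_of_neg hy, h1, h2, smul_smul, inv_neg, neg_mul, inv_mul_cancel₀ hy.ne]
    simp
  · subst hy
    have hc : (starRingEnd ℂ) ⟨x, 0⟩ = (⟨x, 0⟩ : ℂ) := by apply Complex.ext <;> simp
    have h2 : stemIm (G ⟨x, 0⟩) = -stemIm (G ⟨x, 0⟩) := by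
      conv_lhs => rw [← hG ⟨x, 0⟩, hc]
      rfl
    have h3 : stemIm (G ⟨x, 0⟩) = 0 := by
      rw [eq_neg_iff_add_eq_zero, ← two_smul ℝ] at h2
      exact (smul_eq_zero.1 h2).resolve_left two_ne_zero
    rw [abs_zero, h3, mul_zero, mul_zero]
  · rw [abs_of_pos hy, smul_smul, inv_mul_cancel₀ hy.ne', one_smul]

/-- The condition defining holomorphy at a point with respect to the imaginary unit `J`. -/
def PlanarHoloAt (J : Quaternion ℝ) (s : ℝ × ℝ → Quaternion ℝ) (p : ℝ × ℝ) : Prop :=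
  ContDiffAt ℝ 1 s p ∧ fderiv ℝ s p (1, 0) + J * fderiv ℝ s p (0, 1) = 0

theorem PlanarHoloAt.add {J : Quaternion ℝ} {s t : ℝ × ℝ → Quaternion ℝ} {p : ℝ × ℝ}
    (hs : PlanarHoloAt J s p) (ht : PlanarHoloAt J t p) :
    PlanarHoloAt J (fun p => s p + t p) p := by
  refine ⟨hs.1.add ht.1, ?_⟩
  rw [fderiv_fun_add (hs.1.differentiableAt one_ne_zero) (ht.1.differentiableAt one_ne_zero)]
  simp only [add_apply, mul_add]
  rw [add_add_add_comm, hs.2, ht.2, add_zero]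

theorem planarHoloAt_of_analyticAt {J : Quaternion ℝ} (hJ : J ∈ QSphere) {c : ℂ → ℂ} {x y : ℝ}
    (hc : AnalyticAt ℂ c ⟨x, y⟩) (e : Quaternion ℝ) :
    PlanarHoloAt J (fun p => (c ⟨p.1, p.2⟩).re • e + (c ⟨p.1, p.2⟩).im • (J * e)) (x, y) := by
  let P : ℝ × ℝ →L[ℝ] ℂ := Complex.equivRealProdCLM.symm
  let L : ℂ →L[ℝ] Quaternion ℝ :=
    Complex.reCLM.smulRight e + Complex.imCLM.smulRight (J * e)
  have hs : (fun p : ℝ × ℝ => (c ⟨p.1, p.2⟩).re • e + (c ⟨p.1, p.2⟩).im • (J * e)) =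
      fun p => L (c (P p)) := rfl
  have hP : P (x, y) = ⟨x, y⟩ := rfl
  rw [hs]
  constructor
  · have h1 : ContDiffAt ℝ 1 c (P (x, y)) := hc.contDiffAt.restrict_scalars ℝ
    exact L.contDiff.contDiffAt.comp _ (h1.comp _ P.contDiff.contDiffAt)
  · have hd : HasDerivAt c (deriv c (P (x, y))) (P (x, y)) := hc.differentiableAt.hasDerivAt
    have hd' := (L.hasFDerivAt.comp _ (hd.hasFDerivAt.restrictScalars ℝ)).comp (x, y) P.hasFDerivAt
    have hd'' : HasFDerivAt (fun p => L (c (P p))) _ (x, y) := hd'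
    rw [hd''.fderiv]
    have p1 : P (1, 0) = 1 := rfl
    have pI : P (0, 1) = Complex.I := rfl
    have hL : ∀ w, L w = w.re • e + w.im • (J * e) := fun w => rfl
    have hJJ : J * (J * e) = -e := by rw [← mul_assoc, mul_self_of_mem_QSphere hJ, neg_one_mul]
    simp only [ContinuousLinearMap.comp_apply, p1, pI]
    simp [hL, mul_add, hJJ]

theorem planarHoloAt_of_qAnalyticAt {J : Quaternion ℝ} (hJ : J ∈ QSphere)
    {G : ℂ → Quaternion ℂ} {x y : ℝ} (hG : QAnalyticAt G ⟨x, y⟩) :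
    PlanarHoloAt J (fun p => stemRe (G ⟨p.1, p.2⟩) + J * stemIm (G ⟨p.1, p.2⟩)) (x, y) := by
  have h := (((planarHoloAt_of_analyticAt hJ hG.1 1).add
    (planarHoloAt_of_analyticAt hJ hG.2.1 unitI)).add
    (planarHoloAt_of_analyticAt hJ hG.2.2.1 unitJ)).add
    (planarHoloAt_of_analyticAt hJ hG.2.2.2 unitK)
  convert h using 2 with p
  ext <;> simp [Quaternion.re_one, Quaternion.imI_one, Quaternion.imJ_one, Quaternion.imK_one] <;>
    ring

theorem sliceRegularOn_sliceOf {Ω : Set (Quaternion ℝ)} (hΩ : IsSymmSliceDomain Ω)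
    {G : ℂ → Quaternion ℂ} (hG : ∀ z, stemConj (G (starRingEnd ℂ z)) = G z)
    (han : ∀ c ∈ planarSet Ω, QAnalyticAt G c) : SliceRegularOn (sliceOf G) Ω := by
  intro J hJ x y hxy
  have h : sliceMap (sliceOf G) J =
      fun p => stemRe (G ⟨p.1, p.2⟩) + J * stemIm (G ⟨p.1, p.2⟩) :=
    funext fun p => sliceOf_slice hG hJ p.1 p.2
  rw [h]
  exact planarHoloAt_of_qAnalyticAt hJ (han _ (mem_planarSet_of_slice_mem hΩ hJ hxy))

/-- The regular product corresponds to the product of stem functions. -/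
theorem starMulVal_sliceOf {f : Quaternion ℝ → Quaternion ℝ} {F G : ℂ → Quaternion ℂ}
    (hG : ∀ z, stemConj (G (starRingEnd ℂ z)) = G z) {I : Quaternion ℝ} (hI : I ∈ QSphere)
    {x y : ℝ} (hf : f ((x : Quaternion ℝ) + (y : Quaternion ℝ) * I) =
      stemRe (F ⟨x, y⟩) + I * stemIm (F ⟨x, y⟩)) :
    starMulVal f (sliceOf G) ((x : Quaternion ℝ) + (y : Quaternion ℝ) * I) =
      stemRe (F ⟨x, y⟩ * G ⟨x, y⟩) + I * stemIm (F ⟨x, y⟩ * G ⟨x, y⟩) := by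
  set α := stemRe (F ⟨x, y⟩)
  set β := stemIm (F ⟨x, y⟩)
  set γ := stemRe (G ⟨x, y⟩) with hγ
  set δ := stemIm (G ⟨x, y⟩) with hδ
  have hprod : F ⟨x, y⟩ * G ⟨x, y⟩ = complexify (α * γ - β * δ) (α * δ + β * γ) := by
    rw [← complexify_mul]
    rfl
  have hII := mul_self_of_mem_QSphere hI
  have hval : stemRe (F ⟨x, y⟩ * G ⟨x, y⟩) + I * stemIm (F ⟨x, y⟩ * G ⟨x, y⟩) =
      (α + I * β) * γ + I * ((α + I * β) * δ) := by
    rw [hprod]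
    change (α * γ - β * δ) + I * (α * δ + β * γ) = _
    have h : I * (I * (β * δ)) = -(β * δ) := by rw [← mul_assoc, hII, neg_one_mul]
    simp only [mul_add, add_mul, mul_assoc, h]
    abel
  rw [hval, starMulVal, hf]
  set p := α + I * β
  split_ifs with hp
  · rw [hp]
    simp
  · have hJ : p⁻¹ * I * p ∈ QSphere := by
      change (p⁻¹ * I * p) ^ 2 = -1
      calc (p⁻¹ * I * p) ^ 2 = p⁻¹ * I * (p * p⁻¹) * I * p := by rw [pow_two]; noncomm_ring
        _ = p⁻¹ * (I * I) * p := by rw [mul_inv_cancel₀ hp]; noncomm_ring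
        _ = -1 := by rw [hII, mul_neg_one, neg_mul, inv_mul_cancel₀ hp]
    have hq : p⁻¹ * ((x : Quaternion ℝ) + (y : Quaternion ℝ) * I) * p =
        (x : Quaternion ℝ) + (y : Quaternion ℝ) * (p⁻¹ * I * p) := by
      rw [mul_add p⁻¹, add_mul _ _ p, ← Quaternion.coe_commutes, mul_assoc (x : Quaternion ℝ),
        inv_mul_cancel₀ hp, mul_one, ← mul_assoc p⁻¹, ← Quaternion.coe_commutes]
      simp only [mul_assoc]
    rw [hq, sliceOf_slice hG hJ, mul_add, ← hγ, ← hδ]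
    simp only [← mul_assoc]
    rw [mul_inv_cancel₀ hp, one_mul]

end

/-- If `n ≥ 1` slice regular functions on a symmetric slice domain `Ω` have no common
zeros, then they generate the whole ring: there are slice regular `h₁, …, hₙ` with
`f₁ * h₁ + ⋯ + fₙ * hₙ = 1` pointwise on `Ω`. -/
theorem ideal_generated_by_n_regular_functions_without_common_zeros
    (Ω : Set (Quaternion ℝ)) (hΩ : IsSymmSliceDomain Ω)
    (n : ℕ) (hn : 1 ≤ n)
    (f : Fin n → Quaternion ℝ → Quaternion ℝ)
    (hreg : ∀ ℓ, SliceRegularOn (f ℓ) Ω)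
    (hnz : ∀ q ∈ Ω, ∃ ℓ, f ℓ q ≠ 0) :
    ∃ h : Fin n → Quaternion ℝ → Quaternion ℝ,
      (∀ ℓ, SliceRegularOn (h ℓ) Ω) ∧
      ∀ q ∈ Ω, (∑ ℓ, starMulVal (f ℓ) (h ℓ) q) = 1 := by
  set F : Fin n → ℂ → Quaternion ℂ := fun ℓ => stemOf (f ℓ) unitI
  have hrep : ∀ ℓ, ∀ I ∈ QSphere, ∀ x y : ℝ, (⟨x, y⟩ : ℂ) ∈ planarSet Ω →
      f ℓ ((x : Quaternion ℝ) + (y : Quaternion ℝ) * I) =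
        stemRe (F ℓ ⟨x, y⟩) + I * stemIm (F ℓ ⟨x, y⟩) :=
    fun ℓ I hI x y hz => slice_eq_stemRe_add_mul_stemIm hΩ (hreg ℓ) hI hz
  have hpt : ∀ c ∈ planarSet Ω, ∃ X : Fin n → Quaternion ℂ, ∑ ℓ, F ℓ c * X ℓ = 1 := by
    rintro ⟨x, y⟩ hc
    refine exists_sum_complexify_mul_eq_one (fun ℓ => stemRe (F ℓ ⟨x, y⟩))
      (fun ℓ => stemIm (F ℓ ⟨x, y⟩)) fun I hI => ?_
    obtain ⟨ℓ, hℓ⟩ := hnz _ (slice_mem_of_mem_planarSet hΩ hI hc)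
    exact ⟨ℓ, by rwa [hrep ℓ I hI x y hc] at hℓ⟩
  obtain ⟨x₀, hx₀⟩ := hΩ.2.2.1
  obtain ⟨ℓ₀, hℓ₀⟩ := hnz _ hx₀
  have hne : Quaternion.normSq (F ℓ₀ x₀) ≠ 0 := by
    rw [show F ℓ₀ x₀ = complexify (f ℓ₀ x₀) 0 from
      stemOf_of_im_eq_zero _ _ (Complex.ofReal_im x₀), normSq_complexify]
    intro h
    have h' := congrArg Complex.re h
    rw [map_zero, sub_zero] at h'
    exact hℓ₀ (Quaternion.normSq_eq_zero.1 h')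
  obtain ⟨H, hHan, hH⟩ := exists_qAnalyticAt_sum_mul_eq_one (isOpen_planarSet hΩ.1)
    (isPreconnected_planarSet (hΩ.2.2.2.1 unitI unitI_mem_QSphere).isPreconnected)
    (fun ℓ c hc => qAnalyticAt_stemOf hΩ unitI_mem_QSphere (hreg ℓ _ unitI_mem_QSphere) hc)
    (show (x₀ : ℂ) ∈ planarSet Ω by simpa [planarSet] using hx₀) hne hpt
  obtain ⟨G, hGan, hFG, hGconj⟩ := exists_symmetric_solution
    (fun z hz => conj_mem_planarSet hΩ hz) (fun ℓ z => stemConj_stemOf (f ℓ) unitI z) hHan hH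
  refine ⟨fun ℓ => sliceOf (G ℓ), fun ℓ => sliceRegularOn_sliceOf hΩ (hGconj ℓ) (hGan ℓ),
    fun q hq => ?_⟩
  obtain ⟨x, y, I, hI, rfl⟩ := exists_eq_add_mul_mem_QSphere q
  have hz := mem_planarSet_of_slice_mem hΩ hI hq
  have hsum : ∑ ℓ, complexify (stemRe (F ℓ ⟨x, y⟩ * G ℓ ⟨x, y⟩))
      (stemIm (F ℓ ⟨x, y⟩ * G ℓ ⟨x, y⟩)) = complexify 1 0 := hFG _ hz
  rw [complexify_sum] at hsum
  obtain ⟨hre, him⟩ := complexify_injective hsum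
  rw [Finset.sum_congr rfl fun ℓ _ => starMulVal_sliceOf (hGconj ℓ) hI (hrep ℓ I hI x y hz),
    Finset.sum_add_distrib, ← Finset.mul_sum, hre, him, mul_zero, add_zero]
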